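/- Equilibrium-cost decomposition over stages: for every encoding σ, the maximum over Bayes-Nash equilibria (τ_1,τ_2) of the block game of the expected average encoder cost E[(1/n)·Σ_{t=1}^n c_e(U_t, V_{1,t}, V_{2,t})] equals the average over t of the per-stage maxima: (1/n)·Σ_{t=1}^n max over Bayes-Nash equilibria (τ_{1,t}, τ_{2,t}) of the stage-t game of E[c_e(U_t, V_{1,t}, V_{2,t})]. -/

import Mathlib

open Finset

/-- A probability distribution on a finite set, given as a weight function. -/
def IsDist {V : Type*} [Fintype V] (q : V → ℝ) : Prop :=
  (∀ v, 0 ≤ q v) ∧ ∑ v, q v = 1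

variable {U M0 M1 M2 V1 V2 : Type*}
variable [Fintype U] [Fintype M0] [Fintype M1] [Fintype M2] [Fintype V1] [Fintype V2]

/-- Expected `σ`-cost of decoder 1 with type `(m₀, m₁)` in the `n`-stage block game:
the joint weight `P uⁿ m₀ m₁ m₂` is the distribution of `(Uⁿ, M₀, M₁, M₂)` induced by
the source and the encoding `σ`, the decoders use behavioral strategies `τ₁, τ₂`,
and the cost is the average of the per-stage costs. -/
noncomputable def PsiBlock1 (n : ℕ)
    (P : (Fin n → U) → M0 → M1 → M2 → ℝ) (c1 : U → V1 → V2 → ℝ)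
    (τ1 : M0 → M1 → (Fin n → V1) → ℝ) (τ2 : M0 → M2 → (Fin n → V2) → ℝ)
    (m0 : M0) (m1 : M1) : ℝ :=
  ∑ un : Fin n → U, ∑ m2 : M2, ∑ v1n : Fin n → V1, ∑ v2n : Fin n → V2,
    P un m0 m1 m2 * τ1 m0 m1 v1n * τ2 m0 m2 v2n *
      ((1 / (n : ℝ)) * ∑ t, c1 (un t) (v1n t) (v2n t))

/-- Expected `σ`-cost of decoder 2 with type `(m₀, m₂)` in the block game. -/
noncomputable def PsiBlock2 (n : ℕ)
    (P : (Fin n → U) → M0 → M1 → M2 → ℝ) (c2 : U → V1 → V2 → ℝ)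
    (τ1 : M0 → M1 → (Fin n → V1) → ℝ) (τ2 : M0 → M2 → (Fin n → V2) → ℝ)
    (m0 : M0) (m2 : M2) : ℝ :=
  ∑ un : Fin n → U, ∑ m1 : M1, ∑ v1n : Fin n → V1, ∑ v2n : Fin n → V2,
    P un m0 m1 m2 * τ1 m0 m1 v1n * τ2 m0 m2 v2n *
      ((1 / (n : ℝ)) * ∑ t, c2 (un t) (v1n t) (v2n t))

/-- Bayes-Nash equilibrium of the block game `G^σ`: each decoder's behavioral
strategy minimizes its expected cost against the other's, for every type. -/
def IsBNEBlock (n : ℕ)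
    (P : (Fin n → U) → M0 → M1 → M2 → ℝ) (c1 c2 : U → V1 → V2 → ℝ)
    (τ1 : M0 → M1 → (Fin n → V1) → ℝ) (τ2 : M0 → M2 → (Fin n → V2) → ℝ) : Prop :=
  (∀ τ1' : M0 → M1 → (Fin n → V1) → ℝ, (∀ m0 m1, IsDist (τ1' m0 m1)) →
      ∀ m0 m1, PsiBlock1 n P c1 τ1 τ2 m0 m1 ≤ PsiBlock1 n P c1 τ1' τ2 m0 m1) ∧
  (∀ τ2' : M0 → M2 → (Fin n → V2) → ℝ, (∀ m0 m2, IsDist (τ2' m0 m2)) →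
      ∀ m0 m2, PsiBlock2 n P c2 τ1 τ2 m0 m2 ≤ PsiBlock2 n P c2 τ1 τ2' m0 m2)

/-- Expected cost of decoder 1 in the stage-`t` game `G^{σ,t}`. -/
noncomputable def PsiStage1 (n : ℕ)
    (P : (Fin n → U) → M0 → M1 → M2 → ℝ) (c1 : U → V1 → V2 → ℝ)
    (σ1 : M0 → M1 → V1 → ℝ) (σ2 : M0 → M2 → V2 → ℝ)
    (t : Fin n) (m0 : M0) (m1 : M1) : ℝ :=
  ∑ un : Fin n → U, ∑ m2 : M2, ∑ v1 : V1, ∑ v2 : V2,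
    P un m0 m1 m2 * σ1 m0 m1 v1 * σ2 m0 m2 v2 * c1 (un t) v1 v2

/-- Expected cost of decoder 2 in the stage-`t` game `G^{σ,t}`. -/
noncomputable def PsiStage2 (n : ℕ)
    (P : (Fin n → U) → M0 → M1 → M2 → ℝ) (c2 : U → V1 → V2 → ℝ)
    (σ1 : M0 → M1 → V1 → ℝ) (σ2 : M0 → M2 → V2 → ℝ)
    (t : Fin n) (m0 : M0) (m2 : M2) : ℝ :=
  ∑ un : Fin n → U, ∑ m1 : M1, ∑ v1 : V1, ∑ v2 : V2,
    P un m0 m1 m2 * σ1 m0 m1 v1 * σ2 m0 m2 v2 * c2 (un t) v1 v2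

/-- Bayes-Nash equilibrium of the stage-`t` game `G^{σ,t}`. -/
def IsBNEStage (n : ℕ)
    (P : (Fin n → U) → M0 → M1 → M2 → ℝ) (c1 c2 : U → V1 → V2 → ℝ)
    (t : Fin n) (σ1 : M0 → M1 → V1 → ℝ) (σ2 : M0 → M2 → V2 → ℝ) : Prop :=
  (∀ σ1' : M0 → M1 → V1 → ℝ, (∀ m0 m1, IsDist (σ1' m0 m1)) →
      ∀ m0 m1, PsiStage1 n P c1 σ1 σ2 t m0 m1 ≤ PsiStage1 n P c1 σ1' σ2 t m0 m1) ∧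
  (∀ σ2' : M0 → M2 → V2 → ℝ, (∀ m0 m2, IsDist (σ2' m0 m2)) →
      ∀ m0 m2, PsiStage2 n P c2 σ1 σ2 t m0 m2 ≤ PsiStage2 n P c2 σ1 σ2' t m0 m2)

/-- Marginal at stage `t` of a block behavioral strategy. -/
noncomputable def stageMarginal1 [DecidableEq V1] (n : ℕ)
    (τ1 : M0 → M1 → (Fin n → V1) → ℝ) (t : Fin n) (m0 : M0) (m1 : M1) (v1 : V1) : ℝ :=
  ∑ v1n : Fin n → V1, if v1n t = v1 then τ1 m0 m1 v1n else 0

/-- Marginal at stage `t` of a block behavioral strategy of decoder 2. -/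
noncomputable def stageMarginal2 [DecidableEq V2] (n : ℕ)
    (τ2 : M0 → M2 → (Fin n → V2) → ℝ) (t : Fin n) (m0 : M0) (m2 : M2) (v2 : V2) : ℝ :=
  ∑ v2n : Fin n → V2, if v2n t = v2 then τ2 m0 m2 v2n else 0

/-- Long-run expected cost of the encoder in the block game. -/
noncomputable def encoderBlockCost (n : ℕ)
    (P : (Fin n → U) → M0 → M1 → M2 → ℝ) (ce : U → V1 → V2 → ℝ)
    (τ1 : M0 → M1 → (Fin n → V1) → ℝ) (τ2 : M0 → M2 → (Fin n → V2) → ℝ) : ℝ :=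
  ∑ un : Fin n → U, ∑ m0 : M0, ∑ m1 : M1, ∑ m2 : M2,
    ∑ v1n : Fin n → V1, ∑ v2n : Fin n → V2,
      P un m0 m1 m2 * τ1 m0 m1 v1n * τ2 m0 m2 v2n *
        ((1 / (n : ℝ)) * ∑ t, ce (un t) (v1n t) (v2n t))

/-- Expected cost of the encoder in the stage-`t` game. -/
noncomputable def encoderStageCost (n : ℕ)
    (P : (Fin n → U) → M0 → M1 → M2 → ℝ) (ce : U → V1 → V2 → ℝ)
    (σ1 : M0 → M1 → V1 → ℝ) (σ2 : M0 → M2 → V2 → ℝ) (t : Fin n) : ℝ :=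
  ∑ un : Fin n → U, ∑ m0 : M0, ∑ m1 : M1, ∑ m2 : M2, ∑ v1 : V1, ∑ v2 : V2,
    P un m0 m1 m2 * σ1 m0 m1 v1 * σ2 m0 m2 v2 * ce (un t) v1 v2

set_option linter.unusedSectionVars false

section Exchange

variable {E W : Type*} [Fintype E] [AddCommGroup W] [Module ℝ W]

/-- `b` is a nonnegative combination of the vectors `d e` with `e ∈ S`. -/
def FeasibleOn (d : E → W) (b : W) (S : Finset E) : Prop :=
  ∃ u : E → ℝ, (∀ e, 0 ≤ u e) ∧ (∀ e, e ∉ S → u e = 0) ∧ ∑ e, u e • d e = b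

/-- `b` is not a linear combination of fewer than `dim W` of the vectors `d e`. -/
def NondegenerateRhs (d : E → W) (b : W) : Prop :=
  ∀ S : Finset E, S.card < Module.finrank ℝ W →
    ∀ u : E → ℝ, (∀ e, e ∉ S → u e = 0) → ∑ e, u e • d e ≠ b

variable [DecidableEq E] {d : E → W} {b : W}

lemma NondegenerateRhs.ne_zero (hb : NondegenerateRhs d b) {S : Finset E}
    (hS : S.card = Module.finrank ℝ W) {u : E → ℝ} (hu : ∀ e, e ∉ S → u e = 0)
    (hsum : ∑ e, u e • d e = b) {e : E} (he : e ∈ S) : u e ≠ 0 := by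
  intro h0
  refine hb (S.erase e) (hS ▸ Finset.card_erase_lt_of_mem he) u (fun a ha => ?_) hsum
  rcases eq_or_ne a e with rfl | hne
  · exact h0
  · exact hu a fun h => ha (Finset.mem_erase.2 ⟨hne, h⟩)

lemma NondegenerateRhs.relation_eq_zero (hb : NondegenerateRhs d b) {S : Finset E}
    (hS : S.card = Module.finrank ℝ W) {u : E → ℝ} (hu : ∀ e, e ∉ S → u e = 0)
    (hsum : ∑ e, u e • d e = b) {k : E → ℝ} (hk : ∀ e, e ∉ S → k e = 0)
    (hk0 : ∑ e, k e • d e = 0) (e : E) : k e = 0 := by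
  by_contra hne
  have he : e ∈ S := by
    by_contra h
    exact hne (hk e h)
  refine hb.ne_zero hS (u := fun a => u a - u e / k e * k a) (fun a ha => ?_) ?_ he ?_
  · simp [hu a ha, hk a ha]
  · simp only [sub_smul, mul_smul, Finset.sum_sub_distrib, ← Finset.smul_sum, hk0, hsum]
    simp
  · field_simp
    ring

lemma exists_relation_of_finrank_lt_card [FiniteDimensional ℝ W] (d : E → W) {C : Finset E}
    (hC : Module.finrank ℝ W < C.card) :
    ∃ k : E → ℝ, (∀ e, e ∉ C → k e = 0) ∧ ∑ e, k e • d e = 0 ∧ ∃ e, k e ≠ 0 := by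
  have hdep : ¬ LinearIndependent ℝ (fun e : C => d e) := by
    intro h
    have := h.fintype_card_le_finrank
    simp at this
    omega
  obtain ⟨g, hg, i, hi⟩ := Fintype.not_linearIndependent_iff.1 hdep
  refine ⟨fun e => if h : e ∈ C then g ⟨e, h⟩ else 0, fun e he => by simp [he], ?_, i, by simpa⟩
  rw [← hg, ← Finset.sum_subset (Finset.subset_univ C) (fun e _ he => by simp [he]),
    ← Finset.sum_coe_sort C]
  simp

open Classical in
/-- In a set of `dim W + 1` columns of a bounded nondegenerate system, the number of feasible
bases is zero or two. -/
lemma even_card_feasible_erase [FiniteDimensional ℝ W] (hb : NondegenerateRhs d b)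
    (hpt : ∀ k : E → ℝ, (∀ e, 0 ≤ k e) → ∑ e, k e • d e = 0 → ∀ e, k e = 0)
    {C : Finset E} (hC : C.card = Module.finrank ℝ W + 1) :
    Even (C.filter fun e => FeasibleOn d b (C.erase e)).card := by
  rcases (C.filter fun e => FeasibleOn d b (C.erase e)).eq_empty_or_nonempty with h0 | ⟨e, he⟩
  · simp [h0]
  obtain ⟨heC, u, hu0, huS, hu⟩ := Finset.mem_filter.1 he
  have hcard : ∀ a ∈ C, (C.erase a).card = Module.finrank ℝ W := fun a ha => by
    rw [Finset.card_erase_of_mem ha, hC, Nat.add_sub_cancel]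
  obtain ⟨k, hkC, hk, hke⟩ : ∃ k : E → ℝ, (∀ a, a ∉ C → k a = 0) ∧ ∑ a, k a • d a = 0 ∧
      k e = 1 := by
    obtain ⟨k, hkC, hk, a, ha⟩ := exists_relation_of_finrank_lt_card d (C := C) (by omega)
    have hke : k e ≠ 0 := by
      intro h
      refine ha (hb.relation_eq_zero (hcard e heC) huS hu (fun c hc => ?_) hk a)
      rcases eq_or_ne c e with rfl | hne
      · exact h
      · exact hkC c fun h => hc (Finset.mem_erase.2 ⟨hne, h⟩)
    refine ⟨fun c => (k e)⁻¹ * k c, fun c hc => by simp [hkC c hc], ?_, inv_mul_cancel₀ hke⟩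
    simp only [mul_smul, ← Finset.smul_sum, hk, smul_zero]
  have hpos : ∀ a ∈ C, a ≠ e → 0 < u a := fun a ha hne =>
    lt_of_le_of_ne (hu0 a)
      (hb.ne_zero (hcard e heC) huS hu (Finset.mem_erase.2 ⟨hne, ha⟩)).symm
  have hue : u e = 0 := huS e (by simp)
  have hneg : (Finset.univ.filter fun a => k a < 0).Nonempty := by
    by_contra h
    rw [Finset.not_nonempty_iff_eq_empty, Finset.filter_eq_empty_iff] at h
    have := hpt k (fun a => not_lt.1 (h (Finset.mem_univ a))) hk e
    rw [hke] at this
    exact one_ne_zero this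
  obtain ⟨f, hf, hmin⟩ := Finset.exists_min_image _ (fun a => u a / -k a) hneg
  simp only [Finset.mem_filter, Finset.mem_univ, true_and] at hf hmin
  have hfC : f ∈ C := by
    by_contra h
    rw [hkC f h] at hf
    exact lt_irrefl _ hf
  have hfe : f ≠ e := by
    rintro rfl
    rw [hke] at hf
    linarith
  set s := u f / -k f with hs
  have hs0 : 0 ≤ s := div_nonneg (hu0 f) (by linarith)
  have hsf : u f + s * k f = 0 := by
    rw [hs]
    field_simp [hf.ne]
    ring
  have hvS : ∀ a, a ∉ C.erase f → u a + s * k a = 0 := fun a ha => by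
    rcases eq_or_ne a f with rfl | hne
    · exact hsf
    · have haC : a ∉ C := fun h => ha (Finset.mem_erase.2 ⟨hne, h⟩)
      rw [hkC a haC, huS a fun h => haC (Finset.mem_of_mem_erase h)]
      simp
  have hv : ∀ r : ℝ, ∑ a, (u a + r * k a) • d a = b := fun r => by
    simp only [add_smul, mul_smul, Finset.sum_add_distrib, ← Finset.smul_sum, hk, hu]
    simp
  have hfmem : f ∈ C.filter fun a => FeasibleOn d b (C.erase a) := by
    refine Finset.mem_filter.2 ⟨hfC, fun a => u a + s * k a, fun a => ?_, hvS, hv s⟩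
    rcases lt_or_ge (k a) 0 with ha | ha
    · have := hmin a ha
      rw [le_div_iff₀ (by linarith)] at this
      linarith
    · have := hu0 a
      positivity
  have huniq : ∀ g ∈ C.filter fun a => FeasibleOn d b (C.erase a), g ≠ e → g = f := by
    intro g hg hge
    obtain ⟨hgC, u', hu'0, hu'S, hu'⟩ := Finset.mem_filter.1 hg
    have hline : ∀ a, u' a = u a + u' e * k a := fun a => by
      have := hb.relation_eq_zero (hcard e heC) huS hu
        (k := fun a => u' a - (u a + u' e * k a)) (fun c hc => ?_) ?_ a
      · linarith
      · rcases eq_or_ne c e with rfl | hne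
        · simp [hue, hke]
        · have hcC : c ∉ C := fun h => hc (Finset.mem_erase.2 ⟨hne, h⟩)
          rw [hkC c hcC, huS c hc, hu'S c fun h => hcC (Finset.mem_of_mem_erase h)]
          simp
      · simp only [sub_smul, Finset.sum_sub_distrib, hu', hv, sub_self]
    have hg0 : u g + u' e * k g = 0 := by
      rw [← hline, hu'S g (by simp)]
    have hkg : k g < 0 := by
      by_contra h
      have h1 := hpos g hgC hge
      have h2 := mul_nonneg (hu'0 e) (not_lt.1 h)
      linarith
    have h1 : s ≤ u' e := by
      have := hmin g hkg
      rw [le_div_iff₀ (by linarith)] at this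
      nlinarith
    have h2 : u' e ≤ s := by
      have := hu'0 f
      rw [hline f] at this
      nlinarith
    by_contra hgf
    refine hb.ne_zero (hcard f hfC) hvS (hv s) (Finset.mem_erase.2 ⟨hgf, hgC⟩) ?_
    rw [le_antisymm h1 h2, hg0]
  have : (C.filter fun a => FeasibleOn d b (C.erase a)) = {e, f} := by
    ext g
    rw [Finset.mem_insert, Finset.mem_singleton]
    constructor
    · intro hg
      by_cases hge : g = e
      · exact Or.inl hge
      · exact Or.inr (huniq g hg hge)
    · rintro (rfl | rfl)
      · exact he
      · exact hfmem
  rw [this, Finset.card_pair hfe.symm]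
  exact even_two

end Exchange

section Complementary

variable {L : Type*} [Fintype L] [DecidableEq L]

/-- The selection of one element from each pair `{(i, false), (i, true)}` given by `φ`. -/
def selection (φ : L → Bool) : Finset (L × Bool) :=
  Finset.univ.image fun i => (i, φ i)

lemma mem_selection {φ : L → Bool} {e : L × Bool} : e ∈ selection φ ↔ e.2 = φ e.1 := by
  simp only [selection, Finset.mem_image, Finset.mem_univ, true_and]
  constructor
  · rintro ⟨i, rfl⟩
    rfl
  · intro h
    exact ⟨e.1, Prod.ext rfl h.symm⟩

lemma selection_injOn (φ : L → Bool) :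
    Set.InjOn (fun i => (i, φ i)) ((Finset.univ : Finset L) : Set L) :=
  fun _ _ _ _ h => congrArg Prod.fst h

lemma card_selection (φ : L → Bool) : (selection φ).card = Fintype.card L := by
  rw [selection, Finset.card_image_of_injOn (selection_injOn φ), Finset.card_univ]

open Classical in
/-- A family of `|L|`-subsets of `L × Bool` having an even number of members inside each
`(|L| + 1)`-set contains an even number of selections. -/
lemma even_card_selection (k : L) (F : Finset (L × Bool) → Prop)
    (hF : ∀ C : Finset (L × Bool), C.card = Fintype.card L + 1 →
      Even (C.filter fun e => F (C.erase e)).card) :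
    Even (Finset.univ.filter fun φ : L → Bool => F (selection φ)).card := by
  let h : Finset (L × Bool) → ZMod 2 := fun S => if F S then 1 else 0
  let C : (L → Bool) → Finset (L × Bool) := fun φ => insert (k, !φ k) (selection φ)
  let flip : L → (L → Bool) → L → Bool := fun i φ => Function.update φ i (!φ i)
  have hmemC : ∀ φ e, e ∈ C φ ↔ (e.1 = k ∨ e.2 = φ e.1) := by
    rintro φ ⟨i, a⟩
    simp only [C, Finset.mem_insert, mem_selection, Prod.mk.injEq]
    constructor
    · tauto
    · rintro (rfl | h)
      · cases a <;> cases φ i <;> simp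
      · exact Or.inr h
  have hnot : ∀ φ : L → Bool, (k, !φ k) ∉ selection φ := fun φ => by simp [mem_selection]
  have hflip : ∀ i φ, flip i (flip i φ) = φ := fun i φ => by simp [flip]
  have hflipk : ∀ i φ, i ≠ k → flip i φ k = φ k := fun i φ hi => by simp [flip, hi.symm]
  have hC0 : ∀ φ, ∑ e ∈ C φ, h ((C φ).erase e) = 0 := fun φ => by
    have hc := hF (C φ) (by rw [Finset.card_insert_of_notMem (hnot φ), card_selection])
    simp only [h]
    rw [Finset.sum_boole]
    exact (ZMod.natCast_eq_zero_iff_even).2 hc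
  have hsplit : ∀ φ, ∑ e ∈ C φ, h ((C φ).erase e) =
      h (selection φ) + (h (selection (flip k φ)) +
        ∑ i ∈ Finset.univ.erase k, h ((C φ).erase (i, φ i))) := fun φ => by
    rw [Finset.sum_insert (hnot φ), Finset.erase_insert (hnot φ)]
    congr 1
    rw [selection, Finset.sum_image (selection_injOn φ),
      ← Finset.add_sum_erase _ _ (Finset.mem_univ k)]
    congr 2
    ext ⟨i, a⟩
    rw [Finset.mem_erase, hmemC, mem_selection]
    rcases eq_or_ne i k with rfl | hi
    · cases a <;> cases hφ : φ i <;> simp [flip, hφ]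
    · simp [flip, hi]
  have halmost : ∀ i ∈ Finset.univ.erase k,
      ∑ φ ∈ Finset.univ.filter (fun φ : L → Bool => φ k = true), h ((C φ).erase (i, φ i)) = 0 := by
    intro i hi
    have hik : i ≠ k := Finset.ne_of_mem_erase hi
    have hinv : ∀ φ, (C (flip i φ)).erase (i, flip i φ i) = (C φ).erase (i, φ i) := fun φ => by
      ext ⟨j, a⟩
      simp only [Finset.mem_erase, hmemC]
      rcases eq_or_ne j i with rfl | hj
      · cases a <;> cases hφ : φ j <;> simp [flip, hφ, hik]
      · simp [flip, hj]
    refine Finset.sum_involution (fun φ _ => flip i φ) (fun φ _ => ?_) (fun φ _ _ => ?_)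
      (fun φ hφ => ?_) (fun φ _ => hflip i φ)
    · rw [hinv]
      exact CharTwo.add_self_eq_zero _
    · intro heq
      have := congrFun heq i
      simp [flip] at this
    · simpa [hflipk i φ hik] using hφ
  have htotal : ∑ φ : L → Bool, h (selection φ) = 0 := by
    have h1 : ∑ φ ∈ Finset.univ.filter (fun φ : L → Bool => ¬ φ k = true), h (selection φ) =
        ∑ φ ∈ Finset.univ.filter (fun φ : L → Bool => φ k = true), h (selection (flip k φ)) := by
      refine Finset.sum_nbij' (flip k) (flip k) ?_ ?_ (fun φ _ => hflip k φ)
        (fun φ _ => hflip k φ) (fun φ _ => by rw [hflip])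
      · intro φ hφ
        simpa [flip] using hφ
      · intro φ hφ
        simpa [flip] using hφ
    rw [← Finset.sum_filter_add_sum_filter_not _ (fun φ : L → Bool => φ k = true), h1,
      ← Finset.sum_add_distrib]
    have h2 := Finset.sum_congr (rfl : Finset.univ.filter (fun φ : L → Bool => φ k = true) = _)
      (fun φ _ => (hsplit φ).symm.trans (hC0 φ))
    simp only [Finset.sum_add_distrib, Finset.sum_const_zero] at h2
    rw [Finset.sum_comm, Finset.sum_eq_zero halmost, add_zero] at h2
    rw [Finset.sum_add_distrib, h2]
  simp only [h] at htotal
  rw [Finset.sum_boole] at htotal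
  exact (ZMod.natCast_eq_zero_iff_even).1 htotal

end Complementary

section Nash

lemma dense_nondegenerateRhs {E W : Type*} [Fintype E] [NormedAddCommGroup W] [NormedSpace ℝ W]
    [FiniteDimensional ℝ W] (d : E → W) : Dense {b | NondegenerateRhs d b} := by
  classical
  let _ : MeasurableSpace W := borel W
  have : BorelSpace W := ⟨rfl⟩
  refine MeasureTheory.Measure.dense_of_ae (μ := MeasureTheory.Measure.addHaar) ?_
  refine Filter.eventually_all.2 fun S => ?_
  by_cases hS : S.card < Module.finrank ℝ W
  · have htop : Submodule.span ℝ ((S.image d : Finset W) : Set W) ≠ ⊤ := by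
      intro h
      have h1 := finrank_span_finset_le_card (R := ℝ) (S.image d)
      rw [Set.finrank, h, finrank_top] at h1
      have h2 := Finset.card_image_le (s := S) (f := d)
      omega
    have hnull := MeasureTheory.Measure.addHaar_submodule MeasureTheory.Measure.addHaar _ htop
    filter_upwards [MeasureTheory.measure_eq_zero_iff_ae_notMem.1 hnull] with b hb _ u hu hsum
    refine hb ?_
    rw [← hsum]
    refine Submodule.sum_mem _ fun e _ => ?_
    by_cases he : e ∈ S
    · exact Submodule.smul_mem _ _
        (Submodule.subset_span (Finset.mem_coe.2 (Finset.mem_image_of_mem d he)))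
    · rw [hu e he, zero_smul]
      exact Submodule.zero_mem _
  · exact Filter.Eventually.of_forall fun b h => absurd h hS

/-- The linear complementarity problem `M z ≤ b`, `z ≥ 0`, with equality in row `l` when
`z l ≠ 0`, has a nonzero solution for some `b` arbitrarily close to the vector `1`. -/
lemma exists_complementary_solution {L : Type*} [Fintype L] [Nonempty L] {M : L → L → ℝ}
    (hM0 : ∀ l i, 0 ≤ M l i)
    (hM : ∀ z : L → ℝ, (∀ i, 0 ≤ z i) → (∀ l, ∑ i, M l i * z i = 0) → ∀ i, z i = 0)
    {ε : ℝ} (hε : 0 < ε) (hε1 : ε < 1) :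
    ∃ b : L → ℝ, (∀ l, 1 - ε ≤ b l ∧ b l ≤ 1 + ε) ∧ ∃ z : L → ℝ, (∀ i, 0 ≤ z i) ∧
      (∃ i, z i ≠ 0) ∧ (∀ l, ∑ i, M l i * z i ≤ b l) ∧
      ∀ l, z l ≠ 0 → ∑ i, M l i * z i = b l := by
  classical
  let d : L × Bool → L → ℝ := fun e => if e.2 then fun l => M l e.1 else Pi.single e.1 1
  have hd : ∀ (u : L × Bool → ℝ) (l : L),
      (∑ e, u e • d e) l = u (l, false) + ∑ i, M l i * u (i, true) := fun u l => by
    simp [d, Fintype.sum_prod_type, Finset.sum_add_distrib, Pi.single_apply, mul_comm, add_comm]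
  obtain ⟨b, hb, hbε⟩ := (dense_nondegenerateRhs d).exists_dist_lt (fun _ => (1 : ℝ)) hε
  have hb1 : ∀ l, 1 - ε ≤ b l ∧ b l ≤ 1 + ε := fun l => by
    have := (dist_le_pi_dist (fun _ => (1 : ℝ)) b l).trans hbε.le
    rw [Real.dist_eq, abs_le] at this
    constructor <;> linarith
  have hfin : Module.finrank ℝ (L → ℝ) = Fintype.card L := Module.finrank_fintype_fun_eq_card ℝ
  have hpt : ∀ k : L × Bool → ℝ, (∀ e, 0 ≤ k e) → ∑ e, k e • d e = 0 → ∀ e, k e = 0 := by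
    intro k hk0 hk
    have hrow : ∀ l, k (l, false) + ∑ i, M l i * k (i, true) = 0 := fun l => by
      rw [← hd, hk, Pi.zero_apply]
    have hnn : ∀ l, 0 ≤ ∑ i, M l i * k (i, true) := fun l =>
      Finset.sum_nonneg fun i _ => mul_nonneg (hM0 l i) (hk0 _)
    have hz := hM (fun i => k (i, true)) (fun i => hk0 _) fun l => by
      linarith [hnn l, hk0 (l, false), hrow l]
    rintro ⟨l, a⟩
    cases a
    · linarith [hnn l, hk0 (l, false), hrow l]
    · exact hz l
  have heven := even_card_selection (Classical.arbitrary L) (FeasibleOn d b) fun C hC =>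
    even_card_feasible_erase hb hpt (hC.trans (by rw [hfin]))
  have hslack : (fun _ => false) ∈
      Finset.univ.filter fun φ : L → Bool => FeasibleOn d b (selection φ) := by
    refine Finset.mem_filter.2 ⟨Finset.mem_univ _, fun e => if e.2 then 0 else b e.1, ?_, ?_, ?_⟩
    · rintro ⟨l, a⟩
      cases a
      · simpa using le_trans (by linarith) (hb1 l).1
      · simp
    · rintro ⟨l, a⟩ h
      cases a
      · simp [mem_selection] at h
      · simp
    · ext l
      rw [hd]
      simp
  obtain ⟨φ, hφ, hne⟩ : ∃ φ ∈ Finset.univ.filter fun φ : L → Bool => FeasibleOn d b (selection φ),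
      φ ≠ fun _ => false := by
    refine Finset.exists_mem_ne ?_ _
    have hpos := Finset.card_pos.2 ⟨_, hslack⟩
    obtain ⟨r, hr⟩ := heven
    omega
  obtain ⟨-, u, hu0, huS, hu⟩ := Finset.mem_filter.1 hφ
  obtain ⟨i, hi⟩ := Function.ne_iff.1 hne
  have hrow : ∀ l, u (l, false) + ∑ i, M l i * u (i, true) = b l := fun l => by rw [← hd, hu]
  refine ⟨b, hb1, fun i => u (i, true), fun i => hu0 _, ⟨i, ?_⟩, fun l => ?_, fun l hl => ?_⟩
  · refine hb.ne_zero ((card_selection φ).trans hfin.symm) huS hu (mem_selection.2 ?_)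
    simpa using hi
  · linarith [hrow l, hu0 (l, false)]
  · have hφl : φ l = true := by
      by_contra h
      exact hl (huS _ (by simpa [mem_selection] using h))
    have : u (l, false) = 0 := huS _ (by simp [mem_selection, hφl])
    linarith [hrow l]

lemma inv_sum_mul_mem_stdSimplex {I : Type*} [Fintype I] {x : I → ℝ} (hx : ∀ i, 0 ≤ x i)
    (hX : 0 < ∑ i, x i) : (fun i => (∑ i, x i)⁻¹ * x i) ∈ stdSimplex ℝ I := by
  refine ⟨fun i => mul_nonneg (inv_nonneg.2 hX.le) (hx i), ?_⟩
  rw [← Finset.mul_sum, inv_mul_cancel₀ hX.ne']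

lemma approx_best_response_of_complementary {I J : Type*} [Fintype I] [Fintype J]
    {A : I → J → ℝ} {x : I → ℝ} {y : J → ℝ} {b : I → ℝ} {ε : ℝ} (hε1 : ε < 1) (hε : 0 < ε)
    (hb : ∀ l, 1 - ε ≤ b l ∧ b l ≤ 1 + ε) (hx : ∀ i, 0 ≤ x i) (hX : 0 < ∑ i, x i)
    (hY : 0 < ∑ j, y j) (hle : ∀ i, ∑ j, A i j * y j ≤ b i)
    (heq : ∀ i, x i ≠ 0 → ∑ j, A i j * y j = b i) (i : I) :
    (1 - ε) * ∑ j, A i j * ((∑ j, y j)⁻¹ * y j) ≤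
      (1 + ε) * ∑ i, ((∑ i, x i)⁻¹ * x i) * ∑ j, A i j * ((∑ j, y j)⁻¹ * y j) := by
  set X := ∑ i, x i
  set Y := ∑ j, y j
  have hpull : ∀ i, ∑ j, A i j * (Y⁻¹ * y j) = Y⁻¹ * ∑ j, A i j * y j := fun i => by
    rw [Finset.mul_sum]
    exact Finset.sum_congr rfl fun j _ => by ring
  have hval : (1 - ε) * X ≤ ∑ i, x i * ∑ j, A i j * y j := by
    rw [Finset.mul_sum]
    refine Finset.sum_le_sum fun i _ => ?_
    by_cases hi : x i = 0
    · simp [hi]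
    · rw [heq i hi, mul_comm]
      exact mul_le_mul_of_nonneg_left (hb i).1 (hx i)
  have hval' : (1 - ε) ≤ X⁻¹ * ∑ i, x i * ∑ j, A i j * y j := by
    rw [inv_mul_eq_div, le_div_iff₀ hX]
    exact hval
  have hrhs : ∑ i, (X⁻¹ * x i) * ∑ j, A i j * (Y⁻¹ * y j) =
      Y⁻¹ * (X⁻¹ * ∑ i, x i * ∑ j, A i j * y j) := by
    simp only [hpull, Finset.mul_sum]
    exact Finset.sum_congr rfl fun i _ => Finset.sum_congr rfl fun j _ => by ring
  rw [hrhs, hpull, mul_left_comm, mul_left_comm (1 + ε)]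
  refine mul_le_mul_of_nonneg_left ?_ (inv_nonneg.2 hY.le)
  have h1 := (hle i).trans (hb i).2
  calc (1 - ε) * ∑ j, A i j * y j ≤ (1 - ε) * (1 + ε) :=
        mul_le_mul_of_nonneg_left h1 (by linarith)
    _ = (1 + ε) * (1 - ε) := mul_comm _ _
    _ ≤ _ := mul_le_mul_of_nonneg_left hval' (by linarith)

lemma exists_approx_nash {I J : Type*} [Fintype I] [Fintype J] [Nonempty I] [Nonempty J]
    {A B : I → J → ℝ} (hA : ∀ i j, 0 < A i j) (hB : ∀ i j, 0 < B i j)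
    {ε : ℝ} (hε : 0 < ε) (hε1 : ε < 1) :
    ∃ x ∈ stdSimplex ℝ I, ∃ y ∈ stdSimplex ℝ J,
      (∀ i, (1 - ε) * ∑ j, A i j * y j ≤ (1 + ε) * ∑ i, x i * ∑ j, A i j * y j) ∧
      (∀ j, (1 - ε) * ∑ i, B i j * x i ≤ (1 + ε) * ∑ j, y j * ∑ i, B i j * x i) := by
  classical
  let M : I ⊕ J → I ⊕ J → ℝ := fun l => Sum.elim
    (fun i => Sum.elim (fun _ : I => 0) (fun j => A i j))
    (fun j => Sum.elim (fun i => B i j) (fun _ : J => 0)) l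
  have hMl : ∀ (z : I ⊕ J → ℝ) i, ∑ k, M (.inl i) k * z k = ∑ j, A i j * z (.inr j) :=
    fun z i => by simp [M, Fintype.sum_sum_type]
  have hMr : ∀ (z : I ⊕ J → ℝ) j, ∑ k, M (.inr j) k * z k = ∑ i, B i j * z (.inl i) :=
    fun z j => by simp [M, Fintype.sum_sum_type]
  obtain ⟨b, hb, z, hz0, hz, hle, heq⟩ := exists_complementary_solution (M := M)
    (by rintro (i | j) (i' | j') <;> simp [M, (hA _ _).le, (hB _ _).le])
    (fun z hz0 hz => by
      have hl := hz (.inl (Classical.arbitrary I))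
      have hr := hz (.inr (Classical.arbitrary J))
      rw [hMl, Finset.sum_eq_zero_iff_of_nonneg
        fun j _ => mul_nonneg (hA _ _).le (hz0 _)] at hl
      rw [hMr, Finset.sum_eq_zero_iff_of_nonneg
        fun j _ => mul_nonneg (hB _ _).le (hz0 _)] at hr
      rintro (i | j)
      · exact (mul_eq_zero.1 (hr i (Finset.mem_univ i))).resolve_left (hB _ _).ne'
      · exact (mul_eq_zero.1 (hl j (Finset.mem_univ j))).resolve_left (hA _ _).ne') hε hε1
  have hposl : ∀ i, z (.inl i) ≠ 0 → 0 < ∑ j, z (.inr j) := fun i hi => by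
    refine (Finset.sum_nonneg fun j _ => hz0 _).lt_of_ne' fun h => ?_
    rw [Finset.sum_eq_zero_iff_of_nonneg fun j _ => hz0 _] at h
    have h1 := heq _ hi
    rw [hMl, Finset.sum_eq_zero fun j hj => by rw [h j hj, mul_zero]] at h1
    linarith [(hb (.inl i)).1]
  have hposr : ∀ j, z (.inr j) ≠ 0 → 0 < ∑ i, z (.inl i) := fun j hj => by
    refine (Finset.sum_nonneg fun i _ => hz0 _).lt_of_ne' fun h => ?_
    rw [Finset.sum_eq_zero_iff_of_nonneg fun i _ => hz0 _] at h
    have h1 := heq _ hj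
    rw [hMr, Finset.sum_eq_zero fun i hi => by rw [h i hi, mul_zero]] at h1
    linarith [(hb (.inr j)).1]
  obtain ⟨hX, hY⟩ : 0 < ∑ i, z (.inl i) ∧ 0 < ∑ j, z (.inr j) := by
    obtain ⟨i | j, hi⟩ := hz
    · have hY := hposl i hi
      obtain ⟨j, -, hj⟩ := Finset.exists_ne_zero_of_sum_ne_zero hY.ne'
      exact ⟨hposr j hj, hY⟩
    · have hX := hposr j hi
      obtain ⟨i, -, hi⟩ := Finset.exists_ne_zero_of_sum_ne_zero hX.ne'
      exact ⟨hX, hposl i hi⟩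
  refine ⟨_, inv_sum_mul_mem_stdSimplex (fun i => hz0 (.inl i)) hX,
    _, inv_sum_mul_mem_stdSimplex (fun j => hz0 (.inr j)) hY, ?_, ?_⟩
  · exact approx_best_response_of_complementary hε1 hε (fun i => hb (.inl i)) (fun i => hz0 _) hX hY
      (fun i => hMl z i ▸ hle _) (fun i hi => hMl z i ▸ heq _ hi)
  · exact approx_best_response_of_complementary (A := fun j i => B i j) hε1 hε
      (fun j => hb (.inr j)) (fun j => hz0 _) hY hX
      (fun j => hMr z j ▸ hle _) (fun j hj => hMr z j ▸ heq _ hj)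

lemma exists_nash_of_pos {I J : Type*} [Fintype I] [Fintype J] [Nonempty I] [Nonempty J]
    {A B : I → J → ℝ} (hA : ∀ i j, 0 < A i j) (hB : ∀ i j, 0 < B i j) :
    ∃ x ∈ stdSimplex ℝ I, ∃ y ∈ stdSimplex ℝ J,
      (∀ i, ∑ j, A i j * y j ≤ ∑ i, x i * ∑ j, A i j * y j) ∧
      (∀ j, ∑ i, B i j * x i ≤ ∑ j, y j * ∑ i, B i j * x i) := by
  let ε : ℕ → ℝ := fun m => 1 / ((m : ℝ) + 1 + 1)
  have hε : ∀ m, 0 < ε m := fun m => by positivity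
  have hε1 : ∀ m, ε m < 1 := fun m => by
    rw [div_lt_one (by positivity)]
    linarith [(Nat.cast_nonneg m : (0 : ℝ) ≤ m)]
  have hlim : Filter.Tendsto ε Filter.atTop (nhds 0) := by
    have := (Filter.tendsto_add_atTop_iff_nat 1).2
      (tendsto_one_div_add_atTop_nhds_zero_nat (𝕜 := ℝ))
    simpa [ε] using this
  choose x hx y hy h1 h2 using fun m => exists_approx_nash hA hB (hε m) (hε1 m)
  obtain ⟨⟨x₀, y₀⟩, ⟨hx₀, hy₀⟩, φ, hφ, hconv⟩ :=
    ((isCompact_stdSimplex ℝ I).prod (isCompact_stdSimplex ℝ J)).tendsto_subseq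
      (x := fun m => (x m, y m)) fun m => ⟨hx m, hy m⟩
  have hxl : ∀ i, Filter.Tendsto (fun m => x (φ m) i) Filter.atTop (nhds (x₀ i)) := fun i =>
    ((continuous_apply i).comp continuous_fst).tendsto (x₀, y₀) |>.comp hconv
  have hyl : ∀ j, Filter.Tendsto (fun m => y (φ m) j) Filter.atTop (nhds (y₀ j)) := fun j =>
    ((continuous_apply j).comp continuous_snd).tendsto (x₀, y₀) |>.comp hconv
  have hεl : Filter.Tendsto (fun m => ε (φ m)) Filter.atTop (nhds 0) :=
    hlim.comp hφ.tendsto_atTop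
  have hAl : ∀ i, Filter.Tendsto (fun m => ∑ j, A i j * y (φ m) j) Filter.atTop
      (nhds (∑ j, A i j * y₀ j)) := fun i =>
    tendsto_finsetSum _ fun j _ => (hyl j).const_mul _
  have hBl : ∀ j, Filter.Tendsto (fun m => ∑ i, B i j * x (φ m) i) Filter.atTop
      (nhds (∑ i, B i j * x₀ i)) := fun j =>
    tendsto_finsetSum _ fun i _ => (hxl i).const_mul _
  refine ⟨x₀, hx₀, y₀, hy₀, fun i => ?_, fun j => ?_⟩
  · have := le_of_tendsto_of_tendsto' ((hεl.const_sub 1).mul (hAl i))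
      ((hεl.const_add 1).mul (tendsto_finsetSum Finset.univ fun i _ => (hxl i).mul (hAl i)))
      fun m => h1 (φ m) i
    simpa using this
  · have := le_of_tendsto_of_tendsto' ((hεl.const_sub 1).mul (hBl j))
      ((hεl.const_add 1).mul (tendsto_finsetSum Finset.univ fun j _ => (hyl j).mul (hBl j)))
      fun m => h2 (φ m) j
    simpa using this

lemma exists_sub_pos {I J : Type*} [Fintype I] [Fintype J] (A : I → J → ℝ) :
    ∃ K : ℝ, ∀ i j, 0 < K - A i j := by
  obtain ⟨K, hK⟩ := (Set.finite_range fun p : I × J => A p.1 p.2).bddAbove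
  refine ⟨K + 1, fun i j => ?_⟩
  have := hK ⟨(i, j), rfl⟩
  simp only at this
  linarith

/-- Every finite two-player game with cost matrices `A` and `B` has a mixed equilibrium. -/
theorem exists_nash {I J : Type*} [Fintype I] [Fintype J] [Nonempty I] [Nonempty J]
    (A B : I → J → ℝ) :
    ∃ x : I → ℝ, IsDist x ∧ ∃ y : J → ℝ, IsDist y ∧
      (∀ i, ∑ i, x i * ∑ j, y j * A i j ≤ ∑ j, y j * A i j) ∧
      (∀ j, ∑ j, y j * ∑ i, x i * B i j ≤ ∑ i, x i * B i j) := by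
  obtain ⟨KA, hKA⟩ := exists_sub_pos A
  obtain ⟨KB, hKB⟩ := exists_sub_pos B
  obtain ⟨x, hx, y, hy, h1, h2⟩ := exists_nash_of_pos hKA hKB
  have hAy : ∀ i, ∑ j, (KA - A i j) * y j = KA - ∑ j, y j * A i j := fun i => by
    simp only [mul_comm (y _), sub_mul, Finset.sum_sub_distrib, ← Finset.mul_sum, hy.2, mul_one]
  have hBx : ∀ j, ∑ i, (KB - B i j) * x i = KB - ∑ i, x i * B i j := fun j => by
    simp only [mul_comm (x _), sub_mul, Finset.sum_sub_distrib, ← Finset.mul_sum, hx.2, mul_one]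
  refine ⟨x, hx, y, hy, fun i => ?_, fun j => ?_⟩
  · have := h1 i
    simp only [hAy, mul_sub, Finset.sum_sub_distrib, ← Finset.sum_mul, hx.2] at this
    linarith
  · have := h2 j
    simp only [hBx, mul_sub, Finset.sum_sub_distrib, ← Finset.sum_mul, hy.2] at this
    linarith

end Nash

section PushWeight

open Classical in
/-- The pushforward of a weight function. -/
noncomputable def pushWeight {S V : Type*} [Fintype S] (f : S → V) (x : S → ℝ) (v : V) : ℝ :=
  ∑ s, if f s = v then x s else 0

lemma sum_pushWeight_mul {S V : Type*} [Fintype S] [Fintype V] (f : S → V) (x : S → ℝ)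
    (g : V → ℝ) : ∑ v, pushWeight f x v * g v = ∑ s, x s * g (f s) := by
  classical
  simp only [pushWeight, Finset.sum_mul, ite_mul, zero_mul]
  rw [Finset.sum_comm]
  simp

lemma IsDist.pushWeight {S V : Type*} [Fintype S] [Fintype V] {x : S → ℝ} (hx : IsDist x)
    (f : S → V) : IsDist (pushWeight f x) := by
  refine ⟨fun v => Finset.sum_nonneg fun s _ => ?_, ?_⟩
  · split_ifs
    · exact hx.1 s
    · exact le_rfl
  · simpa [hx.2] using sum_pushWeight_mul f x fun _ => 1

lemma IsDist.le_one {V : Type*} [Fintype V] {q : V → ℝ} (hq : IsDist q) (v : V) : q v ≤ 1 :=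
  hq.2 ▸ Finset.single_le_sum (fun w _ => hq.1 w) (Finset.mem_univ v)

lemma IsDist.le_sum_mul {V : Type*} [Fintype V] {q : V → ℝ} (hq : IsDist q) {g : V → ℝ} {a : ℝ}
    (hg : ∀ v, a ≤ g v) : a ≤ ∑ v, q v * g v := by
  calc a = ∑ v, q v * a := by rw [← Finset.sum_mul, hq.2, one_mul]
    _ ≤ _ := Finset.sum_le_sum fun v _ => mul_le_mul_of_nonneg_left (hg v) (hq.1 v)

lemma sum_sum_pushWeight_mul {S S' V V' : Type*} [Fintype S] [Fintype S'] [Fintype V] [Fintype V']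
    (f : S → V) (f' : S' → V') (x : S → ℝ) (y : S' → ℝ) (p : ℝ) (g : V → V' → ℝ) :
    ∑ v, ∑ w, p * pushWeight f x v * pushWeight f' y w * g v w =
      ∑ s, ∑ s', p * x s * y s' * g (f s) (f' s') := by
  calc ∑ v, ∑ w, p * pushWeight f x v * pushWeight f' y w * g v w
      = p * ∑ v, pushWeight f x v * ∑ w, pushWeight f' y w * g v w := by
        simp only [Finset.mul_sum, mul_assoc]
    _ = ∑ s, ∑ s', p * x s * y s' * g (f s) (f' s') := by
        rw [sum_pushWeight_mul]
        simp only [sum_pushWeight_mul]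
        simp only [Finset.mul_sum, mul_assoc]

lemma prod_isDist {n : ℕ} {V : Type*} [Fintype V] {q : Fin n → V → ℝ} (hq : ∀ t, IsDist (q t)) :
    IsDist fun vn : Fin n → V => ∏ t, q t (vn t) := by
  classical
  refine ⟨fun vn => Finset.prod_nonneg fun t _ => (hq t).1 _, ?_⟩
  have := Finset.prod_univ_sum (fun _ : Fin n => (Finset.univ : Finset V)) q
  rw [Fintype.piFinset_univ] at this
  rw [← this]
  exact Finset.prod_eq_one fun t _ => (hq t).2

lemma pushWeight_prod {n : ℕ} {V : Type*} [Fintype V] {q : Fin n → V → ℝ}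
    (hq : ∀ t, IsDist (q t)) (t : Fin n) :
    pushWeight (fun vn : Fin n → V => vn t) (fun vn => ∏ s, q s (vn s)) = q t := by
  classical
  ext v
  have := Finset.prod_univ_sum (fun _ : Fin n => (Finset.univ : Finset V))
    fun s w => if s = t then (if w = v then q s w else 0) else q s w
  rw [Fintype.piFinset_univ, Finset.prod_eq_single t (fun s _ hs => by simp [hs, (hq s).2])
    (by simp)] at this
  simp only [if_true, Finset.sum_ite_eq', Finset.mem_univ] at this
  rw [this]
  refine Finset.sum_congr rfl fun vn _ => ?_
  split_ifs with h
  · refine Finset.prod_congr rfl fun s _ => ?_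
    split_ifs with hs h'
    · rfl
    · exact absurd (hs ▸ h) h'
    · rfl
  · exact (Finset.prod_eq_zero (Finset.mem_univ t) (by simp [h])).symm

/-- A mixed strategy that is optimal against all pure strategies `s : T → V` for the total cost
`∑ m, K m (s m)` is optimal for each type `m` separately. -/
lemma typewise_optimal {T V : Type*} [Fintype T] [DecidableEq T] [Fintype V] [Nonempty V]
    {x : (T → V) → ℝ} (hx : IsDist x) (K : T → V → ℝ)
    (h : ∀ s : T → V, ∑ i, x i * ∑ m, K m (i m) ≤ ∑ m, K m (s m)) (m : T) (v : V) :
    ∑ w, pushWeight (fun i : T → V => i m) x w * K m w ≤ K m v := by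
  choose s hs using fun m => Finite.exists_min (K m)
  have hle : ∀ m, K m (s m) ≤ ∑ w, pushWeight (fun i : T → V => i m) x w * K m w := fun m =>
    (hx.pushWeight _).le_sum_mul (hs m)
  have htot : ∑ m, ∑ w, pushWeight (fun i : T → V => i m) x w * K m w ≤ ∑ m, K m (s m) := by
    refine le_trans (le_of_eq ?_) (h s)
    simp only [sum_pushWeight_mul, Finset.mul_sum]
    exact Finset.sum_comm
  have heq := (Finset.sum_eq_sum_iff_of_le fun m _ => hle m).1
    (le_antisymm (Finset.sum_le_sum fun m _ => hle m) htot) m (Finset.mem_univ m)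
  exact heq ▸ hs m v

end PushWeight

section Games

variable {n : ℕ}

/-- Optimality of decoder 1 in the stage-`t` game, for every type. -/
def IsStageOptimal (P : (Fin n → U) → M0 → M1 → M2 → ℝ) (c : U → V1 → V2 → ℝ) (t : Fin n)
    (σ1 : M0 → M1 → V1 → ℝ) (σ2 : M0 → M2 → V2 → ℝ) : Prop :=
  ∀ σ1' : M0 → M1 → V1 → ℝ, (∀ m0 m1, IsDist (σ1' m0 m1)) →
    ∀ m0 m1, PsiStage1 n P c σ1 σ2 t m0 m1 ≤ PsiStage1 n P c σ1' σ2 t m0 m1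

/-- Optimality of decoder 1 in the block game, for every type. -/
def IsBlockOptimal (P : (Fin n → U) → M0 → M1 → M2 → ℝ) (c : U → V1 → V2 → ℝ)
    (τ1 : M0 → M1 → (Fin n → V1) → ℝ) (τ2 : M0 → M2 → (Fin n → V2) → ℝ) : Prop :=
  ∀ τ1' : M0 → M1 → (Fin n → V1) → ℝ, (∀ m0 m1, IsDist (τ1' m0 m1)) →
    ∀ m0 m1, PsiBlock1 n P c τ1 τ2 m0 m1 ≤ PsiBlock1 n P c τ1' τ2 m0 m1

lemma PsiStage2_eq_PsiStage1_swap (P : (Fin n → U) → M0 → M1 → M2 → ℝ) (c : U → V1 → V2 → ℝ)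
    (σ1 : M0 → M1 → V1 → ℝ) (σ2 : M0 → M2 → V2 → ℝ) (t : Fin n) (m0 : M0) (m2 : M2) :
    PsiStage2 n P c σ1 σ2 t m0 m2 =
      PsiStage1 n (fun un m0 m2 m1 => P un m0 m1 m2) (fun u v2 v1 => c u v1 v2) σ2 σ1 t m0 m2 := by
  refine Finset.sum_congr rfl fun un _ => Finset.sum_congr rfl fun m1 _ => ?_
  rw [Finset.sum_comm]
  simp only [mul_right_comm (P un m0 m1 m2)]

lemma PsiBlock2_eq_PsiBlock1_swap (P : (Fin n → U) → M0 → M1 → M2 → ℝ) (c : U → V1 → V2 → ℝ)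
    (τ1 : M0 → M1 → (Fin n → V1) → ℝ) (τ2 : M0 → M2 → (Fin n → V2) → ℝ) (m0 : M0) (m2 : M2) :
    PsiBlock2 n P c τ1 τ2 m0 m2 =
      PsiBlock1 n (fun un m0 m2 m1 => P un m0 m1 m2) (fun u v2 v1 => c u v1 v2) τ2 τ1 m0 m2 := by
  refine Finset.sum_congr rfl fun un _ => Finset.sum_congr rfl fun m1 _ => ?_
  rw [Finset.sum_comm]
  simp only [mul_right_comm (P un m0 m1 m2)]

lemma isBNEStage_iff (P : (Fin n → U) → M0 → M1 → M2 → ℝ) (c1 c2 : U → V1 → V2 → ℝ) (t : Fin n)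
    (σ1 : M0 → M1 → V1 → ℝ) (σ2 : M0 → M2 → V2 → ℝ) :
    IsBNEStage n P c1 c2 t σ1 σ2 ↔ IsStageOptimal P c1 t σ1 σ2 ∧
      IsStageOptimal (fun un m0 m2 m1 => P un m0 m1 m2) (fun u v2 v1 => c2 u v1 v2) t σ2 σ1 := by
  simp only [IsBNEStage, IsStageOptimal, PsiStage2_eq_PsiStage1_swap]

lemma isBNEBlock_iff (P : (Fin n → U) → M0 → M1 → M2 → ℝ) (c1 c2 : U → V1 → V2 → ℝ)
    (τ1 : M0 → M1 → (Fin n → V1) → ℝ) (τ2 : M0 → M2 → (Fin n → V2) → ℝ) :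
    IsBNEBlock n P c1 c2 τ1 τ2 ↔ IsBlockOptimal P c1 τ1 τ2 ∧
      IsBlockOptimal (fun un m0 m2 m1 => P un m0 m1 m2) (fun u v2 v1 => c2 u v1 v2) τ2 τ1 := by
  simp only [IsBNEBlock, IsBlockOptimal, PsiBlock2_eq_PsiBlock1_swap]

/-- Marginal strategy at stage `t` of a block strategy of either decoder. -/
noncomputable def stageStrategy {M V : Type*} [Fintype V] (τ : M0 → M → (Fin n → V) → ℝ)
    (t : Fin n) (m0 : M0) (m : M) : V → ℝ :=
  pushWeight (fun vn => vn t) (τ m0 m)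

/-- The block strategy playing `σ t` independently at each stage `t`. -/
noncomputable def prodStrategy {M V : Type*} (σ : Fin n → M0 → M → V → ℝ) (m0 : M0) (m : M)
    (vn : Fin n → V) : ℝ :=
  ∏ t, σ t m0 m (vn t)

lemma stageStrategy_prodStrategy {M V : Type*} [Fintype V] {σ : Fin n → M0 → M → V → ℝ}
    (hσ : ∀ t m0 m, IsDist (σ t m0 m)) (t : Fin n) :
    stageStrategy (prodStrategy σ) t = σ t := by
  ext m0 m : 2
  exact pushWeight_prod (fun t => hσ t m0 m) t

lemma sum_block_eq_sum_stage (x : (Fin n → V1) → ℝ) (y : (Fin n → V2) → ℝ) (p : ℝ)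
    (g : Fin n → V1 → V2 → ℝ) :
    ∑ a, ∑ b, p * x a * y b * ((1 / (n : ℝ)) * ∑ t, g t (a t) (b t)) =
      (1 / (n : ℝ)) * ∑ t, ∑ v, ∑ w,
        p * pushWeight (fun vn => vn t) x v * pushWeight (fun vn => vn t) y w * g t v w := by
  simp only [sum_sum_pushWeight_mul, Finset.mul_sum]
  rw [Finset.sum_comm (s := (Finset.univ : Finset (Fin n)))]
  refine Finset.sum_congr rfl fun a _ => ?_
  rw [Finset.sum_comm]
  exact Finset.sum_congr rfl fun b _ => Finset.sum_congr rfl fun t _ => by ring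

lemma PsiBlock1_eq (P : (Fin n → U) → M0 → M1 → M2 → ℝ) (c : U → V1 → V2 → ℝ)
    (τ1 : M0 → M1 → (Fin n → V1) → ℝ) (τ2 : M0 → M2 → (Fin n → V2) → ℝ) (m0 : M0) (m1 : M1) :
    PsiBlock1 n P c τ1 τ2 m0 m1 = (1 / (n : ℝ)) *
      ∑ t, PsiStage1 n P c (stageStrategy τ1 t) (stageStrategy τ2 t) t m0 m1 := by
  simp only [PsiBlock1, PsiStage1, stageStrategy]
  simp only [fun un m2 => sum_block_eq_sum_stage (τ1 m0 m1) (τ2 m0 m2) (P un m0 m1 m2)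
    fun t => c (un t), ← Finset.mul_sum, Finset.sum_comm (γ := Fin n)]

lemma encoderBlockCost_eq (P : (Fin n → U) → M0 → M1 → M2 → ℝ) (c : U → V1 → V2 → ℝ)
    (τ1 : M0 → M1 → (Fin n → V1) → ℝ) (τ2 : M0 → M2 → (Fin n → V2) → ℝ) :
    encoderBlockCost n P c τ1 τ2 = (1 / (n : ℝ)) *
      ∑ t, encoderStageCost n P c (stageStrategy τ1 t) (stageStrategy τ2 t) t := by
  simp only [encoderBlockCost, encoderStageCost, stageStrategy]
  simp only [fun un m0 m1 m2 => sum_block_eq_sum_stage (τ1 m0 m1) (τ2 m0 m2) (P un m0 m1 m2)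
    fun t => c (un t), ← Finset.mul_sum, Finset.sum_comm (γ := Fin n)]

lemma isBlockOptimal_iff (hn : 0 < n) {P : (Fin n → U) → M0 → M1 → M2 → ℝ} {c : U → V1 → V2 → ℝ}
    {τ1 : M0 → M1 → (Fin n → V1) → ℝ} {τ2 : M0 → M2 → (Fin n → V2) → ℝ}
    (hτ1 : ∀ m0 m1, IsDist (τ1 m0 m1)) :
    IsBlockOptimal P c τ1 τ2 ↔
      ∀ t, IsStageOptimal P c t (stageStrategy τ1 t) (stageStrategy τ2 t) := by
  have hn' : (0 : ℝ) < 1 / n := by positivity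
  constructor
  · intro h t σ1' hσ1' m0 m1
    by_contra! hlt
    have hdist : ∀ s m0 m1, IsDist (Function.update (stageStrategy τ1) t σ1' s m0 m1) := by
      intro s m0 m1
      rcases eq_or_ne s t with rfl | hs
      · simpa using hσ1' m0 m1
      · rw [Function.update_of_ne hs]
        exact (hτ1 m0 m1).pushWeight _
    have hle := h (prodStrategy (Function.update (stageStrategy τ1) t σ1'))
      (fun m0 m1 => prod_isDist fun s => hdist s m0 m1) m0 m1
    rw [PsiBlock1_eq, PsiBlock1_eq] at hle
    refine absurd (le_of_mul_le_mul_left hle hn') (not_le.2 ?_)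
    simp only [stageStrategy_prodStrategy hdist]
    refine Finset.sum_lt_sum (fun s _ => ?_) ⟨t, Finset.mem_univ t, by simpa using hlt⟩
    rcases eq_or_ne s t with rfl | hs
    · simpa using hlt.le
    · simp [hs]
  · intro h τ1' hτ1' m0 m1
    rw [PsiBlock1_eq, PsiBlock1_eq]
    exact mul_le_mul_of_nonneg_left (Finset.sum_le_sum fun t _ =>
      h t _ (fun m0 m1 => (hτ1' m0 m1).pushWeight _) m0 m1) hn'.le

lemma isBNEBlock_iff_forall_stage (hn : 0 < n) {P : (Fin n → U) → M0 → M1 → M2 → ℝ}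
    {c1 c2 : U → V1 → V2 → ℝ}
    {τ1 : M0 → M1 → (Fin n → V1) → ℝ} {τ2 : M0 → M2 → (Fin n → V2) → ℝ}
    (hτ1 : ∀ m0 m1, IsDist (τ1 m0 m1)) (hτ2 : ∀ m0 m2, IsDist (τ2 m0 m2)) :
    IsBNEBlock n P c1 c2 τ1 τ2 ↔
      ∀ t, IsBNEStage n P c1 c2 t (stageStrategy τ1 t) (stageStrategy τ2 t) := by
  simp only [isBNEBlock_iff, isBNEStage_iff, isBlockOptimal_iff hn hτ1, isBlockOptimal_iff hn hτ2,
    forall_and]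

/-- Expected stage-`t` cost of decoder 1 with type `(m0, m1)` when it plays `v`. -/
noncomputable def actionCost (P : (Fin n → U) → M0 → M1 → M2 → ℝ) (c : U → V1 → V2 → ℝ)
    (σ2 : M0 → M2 → V2 → ℝ) (t : Fin n) (m0 : M0) (m1 : M1) (v : V1) : ℝ :=
  ∑ un : Fin n → U, ∑ m2 : M2, P un m0 m1 m2 * ∑ v2 : V2, σ2 m0 m2 v2 * c (un t) v v2

lemma PsiStage1_eq_sum_actionCost (P : (Fin n → U) → M0 → M1 → M2 → ℝ) (c : U → V1 → V2 → ℝ)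
    (σ1 : M0 → M1 → V1 → ℝ) (σ2 : M0 → M2 → V2 → ℝ) (t : Fin n) (m0 : M0) (m1 : M1) :
    PsiStage1 n P c σ1 σ2 t m0 m1 = ∑ v, σ1 m0 m1 v * actionCost P c σ2 t m0 m1 v := by
  simp only [PsiStage1, actionCost, Finset.mul_sum, Finset.sum_comm (γ := V1)]
  refine Finset.sum_congr rfl fun v _ => Finset.sum_congr rfl fun un _ =>
    Finset.sum_congr rfl fun m2 _ => Finset.sum_congr rfl fun v2 _ => by ring

/-- Total stage-`t` cost of decoder 1, over all its types, under pure strategies. -/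
noncomputable def pureCost (P : (Fin n → U) → M0 → M1 → M2 → ℝ) (c : U → V1 → V2 → ℝ) (t : Fin n)
    (i : M0 × M1 → V1) (j : M0 × M2 → V2) : ℝ :=
  ∑ m : M0 × M1, ∑ un : Fin n → U, ∑ m2 : M2,
    P un m.1 m.2 m2 * c (un t) (i m) (j (m.1, m2))

lemma sum_mul_pureCost [DecidableEq (M0 × M2)] (P : (Fin n → U) → M0 → M1 → M2 → ℝ)
    (c : U → V1 → V2 → ℝ) (t : Fin n) (i : M0 × M1 → V1) (y : (M0 × M2 → V2) → ℝ) :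
    ∑ j, y j * pureCost P c t i j = ∑ m : M0 × M1, actionCost P c
      (fun m0 m2 => pushWeight (fun j : M0 × M2 → V2 => j (m0, m2)) y) t m.1 m.2 (i m) := by
  simp only [pureCost, actionCost, sum_pushWeight_mul, Finset.mul_sum,
    Finset.sum_comm (γ := M0 × M2 → V2)]
  refine Finset.sum_congr rfl fun j _ => Finset.sum_congr rfl fun m _ =>
    Finset.sum_congr rfl fun un _ => Finset.sum_congr rfl fun m2 _ => by ring

lemma isStageOptimal_of_pure [DecidableEq (M0 × M1)] [DecidableEq (M0 × M2)] [Nonempty V1]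
    {P : (Fin n → U) → M0 → M1 → M2 → ℝ} {c : U → V1 → V2 → ℝ} {t : Fin n}
    {x : (M0 × M1 → V1) → ℝ} (hx : IsDist x) {y : (M0 × M2 → V2) → ℝ}
    (h : ∀ s, ∑ i, x i * ∑ j, y j * pureCost P c t i j ≤ ∑ j, y j * pureCost P c t s j) :
    IsStageOptimal P c t (fun m0 m1 => pushWeight (fun i : M0 × M1 → V1 => i (m0, m1)) x)
      (fun m0 m2 => pushWeight (fun j : M0 × M2 → V2 => j (m0, m2)) y) := by
  simp only [sum_mul_pureCost] at h
  intro σ1' hσ1' m0 m1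
  rw [PsiStage1_eq_sum_actionCost, PsiStage1_eq_sum_actionCost]
  exact (hσ1' m0 m1).le_sum_mul fun v => typewise_optimal hx
    (fun m : M0 × M1 => actionCost P c
      (fun m0 m2 => pushWeight (fun j : M0 × M2 → V2 => j (m0, m2)) y) t m.1 m.2) h (m0, m1) v

lemma exists_isBNEStage [Nonempty V1] [Nonempty V2] (P : (Fin n → U) → M0 → M1 → M2 → ℝ)
    (c1 c2 : U → V1 → V2 → ℝ) (t : Fin n) :
    ∃ σ1 : M0 → M1 → V1 → ℝ, ∃ σ2 : M0 → M2 → V2 → ℝ,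
      (∀ m0 m1, IsDist (σ1 m0 m1)) ∧ (∀ m0 m2, IsDist (σ2 m0 m2)) ∧
      IsBNEStage n P c1 c2 t σ1 σ2 := by
  classical
  obtain ⟨x, hx, y, hy, h1, h2⟩ := exists_nash (pureCost P c1 t) fun i j =>
    pureCost (fun un m0 m2 m1 => P un m0 m1 m2) (fun u v2 v1 => c2 u v1 v2) t j i
  exact ⟨_, _, fun _ _ => hx.pushWeight _, fun _ _ => hy.pushWeight _, (isBNEStage_iff ..).2
    ⟨isStageOptimal_of_pure hx h1, isStageOptimal_of_pure hy h2⟩⟩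

lemma encoderStageCost_le {P : (Fin n → U) → M0 → M1 → M2 → ℝ}
    (hP : ∀ un m0 m1 m2, 0 ≤ P un m0 m1 m2) (c : U → V1 → V2 → ℝ)
    {σ1 : M0 → M1 → V1 → ℝ} {σ2 : M0 → M2 → V2 → ℝ}
    (h1 : ∀ m0 m1, IsDist (σ1 m0 m1)) (h2 : ∀ m0 m2, IsDist (σ2 m0 m2)) (t : Fin n) :
    encoderStageCost n P c σ1 σ2 t ≤ ∑ un : Fin n → U, ∑ m0 : M0, ∑ m1 : M1, ∑ m2 : M2,
      ∑ v1 : V1, ∑ v2 : V2, P un m0 m1 m2 * |c (un t) v1 v2| := by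
  refine Finset.sum_le_sum fun un _ => Finset.sum_le_sum fun m0 _ => Finset.sum_le_sum fun m1 _ =>
    Finset.sum_le_sum fun m2 _ => Finset.sum_le_sum fun v1 _ => Finset.sum_le_sum fun v2 _ => ?_
  have hp := hP un m0 m1 m2
  have hw : P un m0 m1 m2 * σ1 m0 m1 v1 * σ2 m0 m2 v2 ≤ P un m0 m1 m2 :=
    (mul_le_of_le_one_right (mul_nonneg hp ((h1 m0 m1).1 v1)) ((h2 m0 m2).le_one v2)).trans
      (mul_le_of_le_one_right hp ((h1 m0 m1).le_one v1))
  have hw0 : 0 ≤ P un m0 m1 m2 * σ1 m0 m1 v1 * σ2 m0 m2 v2 :=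
    mul_nonneg (mul_nonneg hp ((h1 m0 m1).1 v1)) ((h2 m0 m2).1 v2)
  exact (mul_le_mul_of_nonneg_left (le_abs_self _) hw0).trans
    (mul_le_mul_of_nonneg_right hw (abs_nonneg _))

end Games

lemma sSup_average {n : ℕ} (S : Fin n → Set ℝ) (hne : ∀ t, (S t).Nonempty)
    (hbdd : ∀ t, BddAbove (S t)) :
    sSup {x | ∃ y : Fin n → ℝ, (∀ t, y t ∈ S t) ∧ x = (1 / (n : ℝ)) * ∑ t, y t} =
      (1 / (n : ℝ)) * ∑ t, sSup (S t) := by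
  have hn : (0 : ℝ) ≤ 1 / n := by positivity
  refine csSup_eq_of_forall_le_of_forall_lt_exists_gt ?_ ?_ fun w hw => ?_
  · choose y hy using hne
    exact ⟨_, y, hy, rfl⟩
  · rintro _ ⟨y, hy, rfl⟩
    exact mul_le_mul_of_nonneg_left (Finset.sum_le_sum fun t _ => le_csSup (hbdd t) (hy t)) hn
  · set δ := (1 / (n : ℝ)) * ∑ t, sSup (S t) - w with hδ
    have hδ0 : 0 < δ := sub_pos.2 hw
    choose y hy hlt using fun t => exists_lt_of_lt_csSup (hne t)
      (sub_lt_self (sSup (S t)) (half_pos hδ0))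
    refine ⟨_, ⟨y, hy, rfl⟩, ?_⟩
    have h1 : (1 / (n : ℝ)) * ∑ t, (sSup (S t) - δ / 2) ≤ (1 / (n : ℝ)) * ∑ t, y t :=
      mul_le_mul_of_nonneg_left (Finset.sum_le_sum fun t _ => (hlt t).le) hn
    have h2 : (1 / (n : ℝ)) * (n * (δ / 2)) ≤ δ / 2 := by
      rw [← mul_assoc, one_div]
      exact mul_le_of_le_one_left (half_pos hδ0).le (inv_mul_le_one)
    rw [Finset.sum_sub_distrib, mul_sub] at h1
    simp only [Finset.sum_const, Finset.card_univ, Fintype.card_fin, nsmul_eq_mul] at h1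
    linarith

/-- **Equilibrium-cost decomposition over stages**: the maximum over Bayes-Nash
equilibria of the block game of the expected average encoder cost equals the
average over stages `t` of the per-stage maxima over stage-`t` equilibria. -/
theorem stmt_5 (n : ℕ) (hn : 0 < n)
    (P : (Fin n → U) → M0 → M1 → M2 → ℝ) (hPnn : ∀ un m0 m1 m2, 0 ≤ P un m0 m1 m2)
    (hP1 : ∑ un : Fin n → U, ∑ m0 : M0, ∑ m1 : M1, ∑ m2 : M2, P un m0 m1 m2 = 1)
    (c1 c2 ce : U → V1 → V2 → ℝ) :
    sSup {x : ℝ | ∃ τ1 : M0 → M1 → (Fin n → V1) → ℝ, ∃ τ2 : M0 → M2 → (Fin n → V2) → ℝ,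
        (∀ m0 m1, IsDist (τ1 m0 m1)) ∧ (∀ m0 m2, IsDist (τ2 m0 m2)) ∧
        IsBNEBlock n P c1 c2 τ1 τ2 ∧ x = encoderBlockCost n P ce τ1 τ2}
      = (1 / (n : ℝ)) * ∑ t : Fin n,
        sSup {x : ℝ | ∃ σ1 : M0 → M1 → V1 → ℝ, ∃ σ2 : M0 → M2 → V2 → ℝ,
          (∀ m0 m1, IsDist (σ1 m0 m1)) ∧ (∀ m0 m2, IsDist (σ2 m0 m2)) ∧
          IsBNEStage n P c1 c2 t σ1 σ2 ∧ x = encoderStageCost n P ce σ1 σ2 t} := by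
  classical
  have hM : Nonempty M0 ∧ Nonempty M1 ∧ Nonempty M2 := by
    obtain ⟨un, -, h⟩ := Finset.exists_ne_zero_of_sum_ne_zero (hP1.trans_ne one_ne_zero)
    obtain ⟨m0, -, h⟩ := Finset.exists_ne_zero_of_sum_ne_zero h
    obtain ⟨m1, -, h⟩ := Finset.exists_ne_zero_of_sum_ne_zero h
    obtain ⟨m2, -, h⟩ := Finset.exists_ne_zero_of_sum_ne_zero h
    exact ⟨⟨m0⟩, ⟨m1⟩, ⟨m2⟩⟩
  obtain ⟨⟨m0⟩, ⟨m1⟩, ⟨m2⟩⟩ := hM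
  let S : Fin n → Set ℝ := fun t =>
    {x : ℝ | ∃ σ1 : M0 → M1 → V1 → ℝ, ∃ σ2 : M0 → M2 → V2 → ℝ,
      (∀ m0 m1, IsDist (σ1 m0 m1)) ∧ (∀ m0 m2, IsDist (σ2 m0 m2)) ∧
      IsBNEStage n P c1 c2 t σ1 σ2 ∧ x = encoderStageCost n P ce σ1 σ2 t}
  have hblock : {x : ℝ | ∃ τ1 : M0 → M1 → (Fin n → V1) → ℝ, ∃ τ2 : M0 → M2 → (Fin n → V2) → ℝ,
      (∀ m0 m1, IsDist (τ1 m0 m1)) ∧ (∀ m0 m2, IsDist (τ2 m0 m2)) ∧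
      IsBNEBlock n P c1 c2 τ1 τ2 ∧ x = encoderBlockCost n P ce τ1 τ2} =
      {x | ∃ y : Fin n → ℝ, (∀ t, y t ∈ S t) ∧ x = (1 / (n : ℝ)) * ∑ t, y t} := by
    ext x
    constructor
    · rintro ⟨τ1, τ2, h1, h2, hbne, rfl⟩
      exact ⟨_, fun t => ⟨stageStrategy τ1 t, stageStrategy τ2 t, fun _ _ => (h1 _ _).pushWeight _,
        fun _ _ => (h2 _ _).pushWeight _, (isBNEBlock_iff_forall_stage hn h1 h2).1 hbne t, rfl⟩,
        encoderBlockCost_eq ..⟩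
    · rintro ⟨y, hy, rfl⟩
      choose σ1 σ2 h1 h2 hbne hcost using hy
      have hd1 : ∀ m0 m1, IsDist (prodStrategy σ1 m0 m1) := fun m0 m1 =>
        prod_isDist fun t => h1 t m0 m1
      have hd2 : ∀ m0 m2, IsDist (prodStrategy σ2 m0 m2) := fun m0 m2 =>
        prod_isDist fun t => h2 t m0 m2
      refine ⟨prodStrategy σ1, prodStrategy σ2, hd1, hd2,
        (isBNEBlock_iff_forall_stage hn hd1 hd2).2 fun t => ?_, ?_⟩
      · rw [stageStrategy_prodStrategy h1, stageStrategy_prodStrategy h2]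
        exact hbne t
      · simp only [encoderBlockCost_eq, stageStrategy_prodStrategy h1,
          stageStrategy_prodStrategy h2, hcost]
  rw [hblock]
  by_cases hV : Nonempty V1 ∧ Nonempty V2
  · obtain ⟨hV1, hV2⟩ := hV
    refine sSup_average S (fun t => ?_) fun t => ?_
    · obtain ⟨σ1, σ2, h1, h2, h⟩ := exists_isBNEStage P c1 c2 t
      exact ⟨_, σ1, σ2, h1, h2, h, rfl⟩
    · refine ⟨∑ un : Fin n → U, ∑ m0 : M0, ∑ m1 : M1, ∑ m2 : M2, ∑ v1 : V1, ∑ v2 : V2,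
        P un m0 m1 m2 * |ce (un t) v1 v2|, ?_⟩
      rintro _ ⟨σ1, σ2, h1, h2, -, rfl⟩
      exact encoderStageCost_le hPnn ce h1 h2 t
  · have hS : ∀ t, S t = ∅ := fun t => by
      refine Set.eq_empty_of_forall_notMem ?_
      rintro _ ⟨σ1, σ2, h1, h2, -, -⟩
      refine hV ⟨?_, ?_⟩
      · by_contra h
        rw [not_nonempty_iff] at h
        simpa using (h1 m0 m1).2
      · by_contra h
        rw [not_nonempty_iff] at h
        simpa using (h2 m0 m2).2
    change _ = (1 / (n : ℝ)) * ∑ t, sSup (S t)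
    have hempty : {x | ∃ y : Fin n → ℝ, (∀ t, y t ∈ S t) ∧ x = (1 / (n : ℝ)) * ∑ t, y t} = ∅ := by
      refine Set.eq_empty_of_forall_notMem ?_
      rintro _ ⟨y, hy, -⟩
      simpa [hS] using hy ⟨0, hn⟩
    rw [hempty]
    simp [hS]
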